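/- For all x, y, z ∈ W, one has y ◁ x ≤ z in Bruhat order if and only if y ≤ z ∗ x⁻¹. -/

import Mathlib

/-! Common setup: a finite Coxeter system, Bruhat order, and the sets
`{u * y : u ≤ x}` and `{x * v : v ≤ y}` used to characterize the
Demazure product `∗` and the operations `▷`, `◁`. -/

/-- The Bruhat order on a Coxeter group: the reflexive-transitive closure of
the relation `u → u * t`, where `t` is a reflection and right multiplication
by `t` increases length. -/
def CoxeterSystem.bruhatLE {B W : Type*} [Group W] {M : CoxeterMatrix B}
    (cs : CoxeterSystem M W) : W → W → Prop :=
  Relation.ReflTransGen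
    (fun u v => ∃ t, cs.IsReflection t ∧ v = u * t ∧ cs.length u < cs.length v)

/-- The set `{u * y : u ∈ W, u ≤ x}`. -/
def CoxeterSystem.lset {B W : Type*} [Group W] {M : CoxeterMatrix B}
    (cs : CoxeterSystem M W) (x y : W) : Set W :=
  {z | ∃ u, cs.bruhatLE u x ∧ z = u * y}

/-- The set `{x * v : v ∈ W, v ≤ y}`. -/
def CoxeterSystem.rset {B W : Type*} [Group W] {M : CoxeterMatrix B}
    (cs : CoxeterSystem M W) (x y : W) : Set W :=
  {z | ∃ v, cs.bruhatLE v y ∧ z = x * v}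

namespace CoxeterSystem

variable {B W : Type*} [Group W] {M : CoxeterMatrix B} (cs : CoxeterSystem M W)

open Classical in
/-- Conjugation by the simple reflection `s i` on the first coordinate, adding `1` to the second
coordinate exactly when the first one is `s i`. -/
noncomputable def signedConj (i : B) : Equiv.Perm (W × ZMod 2) :=
  Function.Involutive.toPerm
    (fun p => (cs.simple i * p.1 * cs.simple i, p.2 + if p.1 = cs.simple i then 1 else 0)) <| by
    rintro ⟨t, ε⟩
    have h : cs.simple i * t * cs.simple i = cs.simple i ↔ t = cs.simple i := by
      constructor
      · intro h
        have := congrArg (fun a => cs.simple i * a * cs.simple i) h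
        simpa [mul_assoc] using this
      · rintro rfl
        simp
    ext
    · simp [mul_assoc]
    · simp only [h, add_assoc, CharTwo.add_self_eq_zero, add_zero]

open Classical in
theorem signedConj_apply (i : B) (t : W) (ε : ZMod 2) :
    cs.signedConj i (t, ε) =
      (cs.simple i * t * cs.simple i, ε + if t = cs.simple i then 1 else 0) := rfl

open Classical in
theorem signedConj_mul_pow_apply (i i' : B) (n : ℕ) (t : W) (ε : ZMod 2) :
    ((cs.signedConj i * cs.signedConj i') ^ n) (t, ε) =
      ((cs.simple i * cs.simple i') ^ n * t * ((cs.simple i * cs.simple i') ^ n)⁻¹,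
        ε + ∑ j ∈ Finset.range (2 * n),
          if t = cs.simple i' * (cs.simple i * cs.simple i') ^ j then 1 else 0) := by
  induction n generalizing t ε with
  | zero => simp
  | succ n ih =>
    set s := cs.simple i with hs
    set s' := cs.simple i' with hs'
    have hss : s * s = 1 := cs.simple_mul_simple_self i
    have hss' : s' * s' = 1 := cs.simple_mul_simple_self i'
    have hsi : s⁻¹ = s := cs.inv_simple i
    have hsi' : s'⁻¹ = s' := cs.inv_simple i'
    have hconj : ∀ a : W, s * (s' * t * s') * s = a ↔ t = s' * (s * a * s) * s' := by
      intro a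
      constructor
      · rintro rfl
        simp [mul_assoc, hs, hs']
      · rintro rfl
        simp [mul_assoc, hs, hs']
    have h1 : s' * t * s' = s ↔ t = s' * (s * s') ^ 1 := by
      constructor
      · intro h
        rw [← h]
        simp [mul_assoc, hs']
      · rintro rfl
        simp [mul_assoc, hs']
    have h2 : ∀ j : ℕ, s * (s' * t * s') * s = s' * (s * s') ^ j ↔
        t = s' * (s * s') ^ (j + 1 + 1) := by
      intro j
      rw [hconj, pow_succ, pow_succ' _ j]
      suffices h : s' * (s * (s' * (s * s') ^ j) * s) * s' =
          s' * (s * s' * (s * s') ^ j * (s * s')) by rw [h]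
      simp only [mul_assoc]
    rw [pow_succ, Equiv.Perm.mul_apply, Equiv.Perm.mul_apply, signedConj_apply, signedConj_apply,
      ih, ← hs, ← hs']
    ext
    · simp [pow_succ, mul_assoc, hsi, hsi']
    · simp only [h1, h2]
      rw [show 2 * (n + 1) = 2 * n + 1 + 1 by ring, Finset.sum_range_succ', Finset.sum_range_succ']
      simp only [zero_add, pow_zero, mul_one]
      ring

theorem isLiftable_signedConj : M.IsLiftable cs.signedConj := by
  classical
  intro i i'
  ext1 ⟨t, ε⟩
  rw [signedConj_mul_pow_apply, two_mul, Finset.sum_range_add]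
  simp [pow_add, CharTwo.add_self_eq_zero]

/-- The action of `W` on `W × ZMod 2` whose second coordinate records the parity of the number of
occurrences of an element in the right inversion sequence of a word. -/
noncomputable def signedConjHom : W →* Equiv.Perm (W × ZMod 2) :=
  cs.lift ⟨cs.signedConj, cs.isLiftable_signedConj⟩

open Classical in
theorem signedConjHom_wordProd_apply (ω : List B) (t : W) (ε : ZMod 2) :
    cs.signedConjHom (cs.wordProd ω) (t, ε) =
      (cs.wordProd ω * t * (cs.wordProd ω)⁻¹, ε + ((cs.rightInvSeq ω).count t : ZMod 2)) := by
  induction ω with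
  | nil => simp
  | cons i ω ih =>
    have hi : cs.signedConjHom (cs.simple i) = cs.signedConj i :=
      cs.lift_apply_simple cs.isLiftable_signedConj i
    have h : cs.wordProd ω * t * (cs.wordProd ω)⁻¹ = cs.simple i ↔
        (cs.wordProd ω)⁻¹ * cs.simple i * cs.wordProd ω = t := by
      constructor
      · intro h
        rw [← h]
        group
      · rintro rfl
        group
    rw [cs.wordProd_cons, map_mul, Equiv.Perm.mul_apply, ih, hi, signedConj_apply]
    ext
    · simp [mul_assoc]
    · simp only [rightInvSeq, List.count_cons, beq_iff_eq, h]
      push_cast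
      ring

/-- The parity of the number of occurrences of `t` in the right inversion sequence of any word
for `w`. -/
noncomputable def invParity (w t : W) : ZMod 2 := (cs.signedConjHom w (t, 0)).2

open Classical in
theorem invParity_wordProd (ω : List B) (t : W) :
    cs.invParity (cs.wordProd ω) t = ((cs.rightInvSeq ω).count t : ZMod 2) := by
  simp [invParity, signedConjHom_wordProd_apply]

theorem signedConjHom_apply (w t : W) (ε : ZMod 2) :
    cs.signedConjHom w (t, ε) = (w * t * w⁻¹, ε + cs.invParity w t) := by
  obtain ⟨ω, rfl⟩ := cs.wordProd_surjective w
  rw [invParity_wordProd, signedConjHom_wordProd_apply]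

theorem invParity_mul (a b t : W) :
    cs.invParity (a * b) t = cs.invParity b t + cs.invParity a (b * t * b⁻¹) := by
  rw [invParity, map_mul, Equiv.Perm.mul_apply, signedConjHom_apply, signedConjHom_apply, zero_add]

theorem invParity_one (t : W) : cs.invParity 1 t = 0 := by
  simp [invParity]

theorem invParity_simple_self (i : B) : cs.invParity (cs.simple i) (cs.simple i) = 1 := by
  classical
  rw [← cs.wordProd_singleton, invParity_wordProd]
  simp

variable {cs}

theorem IsReflection.invParity_self {t : W} (ht : cs.IsReflection t) :
    cs.invParity t t = 1 := by
  obtain ⟨u, i, rfl⟩ := ht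
  have h1 := cs.invParity_mul (u * cs.simple i) u⁻¹ (u * cs.simple i * u⁻¹)
  have h2 := cs.invParity_mul u (cs.simple i) (cs.simple i)
  have h3 := cs.invParity_mul u u⁻¹ (u * cs.simple i * u⁻¹)
  have e : u⁻¹ * (u * cs.simple i * u⁻¹) * u⁻¹⁻¹ = cs.simple i := by group
  rw [e] at h1 h3
  rw [invParity_simple_self, mul_inv_cancel_right] at h2
  rw [mul_inv_cancel, invParity_one] at h3
  rw [h1, h2]
  linear_combination -h3

theorem length_mul_lt_of_invParity_ne_zero {w t : W} (h : cs.invParity w t ≠ 0) :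
    cs.length (w * t) < cs.length w := by
  classical
  obtain ⟨ω, hω, rfl⟩ := cs.exists_isReduced w
  rw [invParity_wordProd] at h
  refine (cs.isRightInversion_of_mem_rightInvSeq hω (t := t) ?_).2
  by_contra hmem
  simp [List.count_eq_zero_of_not_mem hmem] at h

theorem IsReflection.invParity_eq_zero_iff {t : W} (ht : cs.IsReflection t) (w : W) :
    cs.invParity w t = 0 ↔ cs.length w < cs.length (w * t) := by
  constructor
  · intro h
    have h1 : cs.invParity (w * t) t = 1 := by
      rw [invParity_mul, ht.invParity_self, mul_inv_cancel_right, h, add_zero]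
    have h2 := length_mul_lt_of_invParity_ne_zero (h1.trans_ne one_ne_zero)
    rwa [mul_assoc, ht.mul_self, mul_one] at h2
  · intro h
    by_contra h0
    exact lt_asymm h (length_mul_lt_of_invParity_ne_zero h0)

theorem length_mul_simple_lt_of_ne {u t : W} {i : B} (ht : cs.IsReflection t)
    (hlt : cs.length u < cs.length (u * t)) (hne : t ≠ cs.simple i) :
    cs.length (u * cs.simple i) < cs.length (u * t * cs.simple i) := by
  classical
  have ht' : cs.IsReflection (cs.simple i * t * cs.simple i) := by
    simpa using ht.conj (cs.simple i)
  have e : u * t * cs.simple i = u * cs.simple i * (cs.simple i * t * cs.simple i) := by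
    simp [mul_assoc]
  have h0 : cs.invParity (cs.simple i) (cs.simple i * t * cs.simple i) = 0 := by
    rw [← cs.wordProd_singleton, invParity_wordProd, List.count_eq_zero_of_not_mem]
    · simp
    · intro h
      simp at h
      exact hne (by rw [eq_inv_of_mul_eq_one_right h, inv_simple])
  rw [e, ← ht'.invParity_eq_zero_iff, invParity_mul, h0, zero_add]
  simpa [mul_assoc] using (ht.invParity_eq_zero_iff u).2 hlt

variable (cs) in
theorem bruhatLE_refl (w : W) : cs.bruhatLE w w := Relation.ReflTransGen.refl

theorem bruhatLE.trans {u v w : W} (h : cs.bruhatLE u v) (h' : cs.bruhatLE v w) :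
    cs.bruhatLE u w := Relation.ReflTransGen.trans h h'

theorem IsReflection.bruhatLE_mul {u t : W} (ht : cs.IsReflection t)
    (h : cs.length u < cs.length (u * t)) : cs.bruhatLE u (u * t) :=
  Relation.ReflTransGen.single ⟨t, ht, rfl, h⟩

theorem bruhatLE_one_iff {u : W} : cs.bruhatLE u 1 ↔ u = 1 := by
  constructor
  · intro h
    rcases Relation.ReflTransGen.cases_tail h with h | ⟨v, -, t, -, -, hlt⟩
    · exact h.symm
    · simp at hlt
  · rintro rfl
    exact cs.bruhatLE_refl 1

theorem bruhatLE.mul_simple {u v : W} (h : cs.bruhatLE u v) (i : B) :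
    cs.bruhatLE (u * cs.simple i) v ∨ cs.bruhatLE (u * cs.simple i) (v * cs.simple i) := by
  induction h with
  | refl => exact Or.inr (cs.bruhatLE_refl _)
  | @tail a b _ hab ih =>
    have hle : cs.bruhatLE a b := Relation.ReflTransGen.single hab
    obtain ⟨t, ht, rfl, hlt⟩ := hab
    rcases ih with ih | ih
    · exact Or.inl (ih.trans hle)
    · by_cases hts : t = cs.simple i
      · exact Or.inl (hts ▸ ih)
      · have hl := length_mul_simple_lt_of_ne ht hlt hts
        have ht' : cs.IsReflection (cs.simple i * t * cs.simple i) := by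
          simpa using ht.conj (cs.simple i)
        exact Or.inr (ih.trans
          (Relation.ReflTransGen.single ⟨_, ht', by simp [mul_assoc], hl⟩))

theorem bruhatLE.le_mul_simple_or {u v : W} (h : cs.bruhatLE u v) (i : B) :
    cs.bruhatLE u (v * cs.simple i) ∨ cs.bruhatLE (u * cs.simple i) (v * cs.simple i) := by
  induction h using Relation.ReflTransGen.head_induction_on with
  | refl => exact Or.inr (cs.bruhatLE_refl _)
  | @head a b hab _ ih =>
    have hle : cs.bruhatLE a b := Relation.ReflTransGen.single hab
    obtain ⟨t, ht, rfl, hlt⟩ := hab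
    rcases ih with ih | ih
    · exact Or.inl (hle.trans ih)
    · by_cases hts : t = cs.simple i
      · subst hts
        exact Or.inl (by simpa using ih)
      · have hl := length_mul_simple_lt_of_ne ht hlt hts
        have ht' : cs.IsReflection (cs.simple i * t * cs.simple i) := by
          simpa using ht.conj (cs.simple i)
        exact Or.inr (bruhatLE.trans
          (Relation.ReflTransGen.single ⟨_, ht', by simp [mul_assoc], hl⟩) ih)

theorem bruhatLE_or_mul_simple_bruhatLE_iff (y z : W) (i : B) :
    cs.bruhatLE y z ∨ cs.bruhatLE (y * cs.simple i) z ↔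
      cs.bruhatLE y z ∨ cs.bruhatLE y (z * cs.simple i) := by
  constructor
  · rintro (h | h)
    · exact Or.inl h
    · simpa using h.mul_simple i
  · rintro (h | h)
    · exact Or.inl h
    · simpa using h.le_mul_simple_or i

theorem bruhatLE_mul_simple_iff {x : W} {i : B}
    (hx : cs.length x < cs.length (x * cs.simple i)) (v : W) :
    cs.bruhatLE v (x * cs.simple i) ↔ cs.bruhatLE v x ∨ cs.bruhatLE (v * cs.simple i) x := by
  rw [bruhatLE_or_mul_simple_bruhatLE_iff]
  exact ⟨Or.inr, fun h => h.elim
    (fun h => h.trans ((cs.isReflection_simple i).bruhatLE_mul hx)) id⟩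

theorem exists_rset_bruhatLE_mul_simple_iff {x : W} {i : B}
    (hx : cs.length x < cs.length (x * cs.simple i)) (y z : W) :
    (∃ v, cs.bruhatLE v (x * cs.simple i) ∧ cs.bruhatLE (y * v) z) ↔
      (∃ v, cs.bruhatLE v x ∧ cs.bruhatLE (y * v) z) ∨
        ∃ v, cs.bruhatLE v x ∧ cs.bruhatLE (y * v) (z * cs.simple i) := by
  constructor
  · rintro ⟨v, hv, h⟩
    rcases (bruhatLE_mul_simple_iff hx v).1 hv with hv | hv
    · exact Or.inl ⟨v, hv, h⟩
    · rcases h.mul_simple i with h | h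
      · exact Or.inl ⟨_, hv, by rwa [← mul_assoc]⟩
      · exact Or.inr ⟨_, hv, by rwa [← mul_assoc]⟩
  · rintro (⟨v, hv, h⟩ | ⟨v, hv, h⟩)
    · exact ⟨v, (bruhatLE_mul_simple_iff hx v).2 (Or.inl hv), h⟩
    · rcases (bruhatLE_or_mul_simple_bruhatLE_iff (y * v) z i).2 (Or.inr h) with h | h
      · exact ⟨v, (bruhatLE_mul_simple_iff hx v).2 (Or.inl hv), h⟩
      · exact ⟨v * cs.simple i, (bruhatLE_mul_simple_iff hx _).2 (Or.inr (by simpa using hv)),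
          by rwa [← mul_assoc]⟩

theorem mul_inv_bruhatLE_mul_simple_mul_inv {u x : W} {i : B}
    (hx : cs.length x < cs.length (x * cs.simple i))
    (hu : cs.length u < cs.length (u * cs.simple i)) :
    cs.bruhatLE (u * x⁻¹) (u * (x * cs.simple i)⁻¹) := by
  have ht : cs.IsReflection (x * cs.simple i * x⁻¹) := (cs.isReflection_simple i).conj x
  have e : u * (x * cs.simple i)⁻¹ = u * x⁻¹ * (x * cs.simple i * x⁻¹) := by
    simp [mul_assoc]
  have hx' : cs.length x⁻¹ < cs.length (x⁻¹ * (x * cs.simple i * x⁻¹)) := by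
    rw [← cs.length_inv x, ← cs.length_inv (x * cs.simple i)] at hx
    simpa [mul_assoc] using hx
  rw [e]
  refine ht.bruhatLE_mul ((ht.invParity_eq_zero_iff _).1 ?_)
  rw [invParity_mul, (ht.invParity_eq_zero_iff _).2 hx', zero_add,
    ← ((cs.isReflection_simple i).invParity_eq_zero_iff u).2 hu]
  congr 1
  group

theorem exists_lset_bruhatLE_mul_simple_iff {x : W} {i : B}
    (hx : cs.length x < cs.length (x * cs.simple i)) (y z : W) :
    (∃ u, cs.bruhatLE u z ∧ cs.bruhatLE y (u * (x * cs.simple i)⁻¹)) ↔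
      (∃ u, cs.bruhatLE u z ∧ cs.bruhatLE y (u * x⁻¹)) ∨
        ∃ u, cs.bruhatLE u (z * cs.simple i) ∧ cs.bruhatLE y (u * x⁻¹) := by
  have e : ∀ u, u * (x * cs.simple i)⁻¹ = u * cs.simple i * x⁻¹ := by
    intro u
    simp [mul_assoc]
  have hleft : ∀ u, cs.bruhatLE u z → cs.bruhatLE y (u * x⁻¹) →
      ∃ u, cs.bruhatLE u z ∧ cs.bruhatLE y (u * (x * cs.simple i)⁻¹) := by
    intro u hu h
    rcases lt_or_gt_of_ne (cs.length_mul_simple_ne u i) with hl | hl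
    · have hus : cs.bruhatLE (u * cs.simple i) u := by
        simpa using (cs.isReflection_simple i).bruhatLE_mul (u := u * cs.simple i)
          (by simpa using hl)
      exact ⟨u * cs.simple i, hus.trans hu, by rw [e]; simpa using h⟩
    · exact ⟨u, hu, h.trans (mul_inv_bruhatLE_mul_simple_mul_inv hx hl)⟩
  constructor
  · rintro ⟨u, hu, h⟩
    rw [e] at h
    exact (hu.mul_simple i).imp (fun hu => ⟨_, hu, h⟩) (fun hu => ⟨_, hu, h⟩)
  · rintro (⟨u, hu, h⟩ | ⟨u, hu, h⟩)
    · exact hleft u hu h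
    · rcases (bruhatLE_or_mul_simple_bruhatLE_iff u z i).2 (Or.inr hu) with hu | hu
      · exact hleft u hu h
      · exact ⟨u * cs.simple i, hu, by rw [e]; simpa using h⟩

variable (cs) in
theorem exists_rset_bruhatLE_iff_exists_lset (x y z : W) :
    (∃ v, cs.bruhatLE v x ∧ cs.bruhatLE (y * v) z) ↔
      ∃ u, cs.bruhatLE u z ∧ cs.bruhatLE y (u * x⁻¹) := by
  induction hn : cs.length x generalizing x z with
  | zero =>
    obtain rfl := cs.length_eq_zero_iff.1 hn
    simp only [bruhatLE_one_iff, exists_eq_left, inv_one, mul_one]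
    exact ⟨fun h => ⟨z, cs.bruhatLE_refl z, h⟩, fun ⟨_, hu, h⟩ => h.trans hu⟩
  | succ n ih =>
    have hx1 : x ≠ 1 := by
      rintro rfl
      simp at hn
    obtain ⟨i, hi⟩ := cs.exists_rightDescent_of_ne_one hx1
    have hlen := cs.isRightDescent_iff.1 hi
    obtain ⟨x', rfl⟩ : ∃ x', x = x' * cs.simple i := ⟨x * cs.simple i, by simp⟩
    rw [cs.simple_mul_simple_cancel_right] at hlen
    rw [exists_rset_bruhatLE_mul_simple_iff (by omega),
      exists_lset_bruhatLE_mul_simple_iff (by omega), ih x' z (by omega), ih x' _ (by omega)]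

end CoxeterSystem

/-- For all `x y z ∈ W`: `y ◁ x ≤ z` in Bruhat order iff `y ≤ z ∗ x⁻¹`. -/
theorem ltr_le_iff {B W : Type*} [Group W] [Finite W] {M : CoxeterMatrix B}
    (cs : CoxeterSystem M W) (star ltr : W → W → W)
    (hstar : ∀ x y : W, star x y ∈ cs.lset x y ∧
      ∀ z ∈ cs.lset x y, cs.bruhatLE z (star x y))
    (hltr : ∀ x y : W, ltr x y ∈ cs.rset x y ∧
      ∀ z ∈ cs.rset x y, cs.bruhatLE (ltr x y) z)
    (x y z : W) :
    cs.bruhatLE (ltr y x) z ↔ cs.bruhatLE y (star z x⁻¹) := by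
  have hl : cs.bruhatLE (ltr y x) z ↔ ∃ v, cs.bruhatLE v x ∧ cs.bruhatLE (y * v) z := by
    constructor
    · intro h
      obtain ⟨v, hv, e⟩ := (hltr y x).1
      exact ⟨v, hv, e ▸ h⟩
    · rintro ⟨v, hv, h⟩
      exact ((hltr y x).2 _ ⟨v, hv, rfl⟩).trans h
  have hr : cs.bruhatLE y (star z x⁻¹) ↔
      ∃ u, cs.bruhatLE u z ∧ cs.bruhatLE y (u * x⁻¹) := by
    constructor
    · intro h
      obtain ⟨u, hu, e⟩ := (hstar z x⁻¹).1
      exact ⟨u, hu, e ▸ h⟩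
    · rintro ⟨u, hu, h⟩
      exact h.trans ((hstar z x⁻¹).2 _ ⟨u, hu, rfl⟩)
  rw [hl, hr]
  exact cs.exists_rset_bruhatLE_iff_exists_lset x y z
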